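/- Let q = r^{s·m_1·m_2⋯m_l} where r is an odd prime power, l and s are positive integers, and m_1·m_2⋯m_l is odd, and suppose q ≡ 1 (mod 4). Let t be an even integer with t dividing r−1 and 0 < t < r−1, and let e be an integer with 0 ≤ e ≤ s−1. Then there exists an MDS self-dual code over F_q of length t·r^e·(1 + r^s + ⋯ + r^{s(m_1−1)})·(1 + r^{s m_1} + ⋯ + r^{s m_1(m_2−1)})⋯(1 + r^{s m_1 m_2⋯m_{l−1}} + ⋯ + r^{s m_1 m_2⋯m_{l−1}(m_l−1)}). -/

import Mathlib

open Finset

/-- The Euclidean dual of a linear code `C ⊆ F^n`. -/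
def euclideanDual {F : Type*} [Field F] {n : ℕ} (C : Submodule F (Fin n → F)) :
    Submodule F (Fin n → F) where
  carrier := {x | ∀ c ∈ C, ∑ i, x i * c i = 0}
  add_mem' := by
    intro a b ha hb c hc
    have h : ∑ i, (a + b) i * c i = (∑ i, a i * c i) + ∑ i, b i * c i := by
      rw [← Finset.sum_add_distrib]
      exact Finset.sum_congr rfl fun i _ => by simp [add_mul]
    simp only [Set.mem_setOf_eq] at *
    rw [h, ha c hc, hb c hc, add_zero]
  zero_mem' := by
    intro c hc
    simp
  smul_mem' := by
    intro r a ha c hc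
    have h : ∑ i, (r • a) i * c i = r * ∑ i, a i * c i := by
      rw [Finset.mul_sum]
      exact Finset.sum_congr rfl fun i _ => by simp [mul_assoc]
    simp only [Set.mem_setOf_eq] at *
    rw [h, ha c hc, mul_zero]

/-- Hamming weight of a word. -/
noncomputable def hWeight {F : Type*} [Field F] {n : ℕ} (c : Fin n → F) : ℕ := Nat.card {i : Fin n // c i ≠ 0}

/-- `C` is an MDS (Euclidean) self-dual code: it equals its Euclidean dual and its
minimum Hamming distance is `n/2 + 1`. -/
def IsMDSSelfDual {F : Type*} [Field F] {n : ℕ} (C : Submodule F (Fin n → F)) : Prop :=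
  C = euclideanDual C ∧
  (∀ c ∈ C, c ≠ 0 → n / 2 + 1 ≤ hWeight c) ∧
  (∃ c ∈ C, c ≠ 0 ∧ hWeight c = n / 2 + 1)

open Classical in
/-- The quadratic character `η` of a field: `1` on nonzero squares, `-1` on nonsquares,
`0` at `0`. -/
noncomputable def quadChar (F : Type*) [Field F] (x : F) : ℤ :=
  if x = 0 then 0 else if IsSquare x then 1 else -1

open Polynomial in
/-- The evaluation code `{(vᵢ f(aᵢ)) : deg f < k}`. -/
noncomputable def evalCode {F : Type*} [Field F] {n : ℕ} (a v : Fin n → F) (k : ℕ) :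
    Submodule F (Fin n → F) :=
  (degreeLT F k).map (LinearMap.pi fun i => v i • leval (a i))

section EvalCode

open Polynomial

variable {F : Type*} [Field F] {n k : ℕ} {a v : Fin n → F}

lemma mem_evalCode {c : Fin n → F} :
    c ∈ evalCode a v k ↔ ∃ f : F[X], f.degree < k ∧ ∀ i, c i = v i * f.eval (a i) := by
  simp only [evalCode, Submodule.mem_map, mem_degreeLT, funext_iff, LinearMap.pi_apply,
    LinearMap.smul_apply, leval_apply, smul_eq_mul]
  exact exists_congr fun f => and_congr_right fun _ => forall_congr' fun i => eq_comm

lemma hWeight_add_card_zeros (c : Fin n → F) :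
    hWeight c + Nat.card {i : Fin n // c i = 0} = n := by
  classical
  have h := Fintype.card_subtype_compl (fun i : Fin n => c i = 0)
  have h2 := Fintype.card_subtype_le (fun i : Fin n => c i = 0)
  simp only [Fintype.card_fin] at h h2
  rw [hWeight, Nat.card_eq_fintype_card, Nat.card_eq_fintype_card, h]
  omega

/-- The zeros of an evaluation codeword are at most the roots of its polynomial. -/
lemma card_zeros_le_natDegree (ha : Function.Injective a) (hv : ∀ i, v i ≠ 0) {f : F[X]}
    (hf : f ≠ 0) {c : Fin n → F} (hc : ∀ i, c i = v i * f.eval (a i)) :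
    Nat.card {i : Fin n // c i = 0} ≤ f.natDegree := by
  classical
  rw [Nat.card_eq_fintype_card, Fintype.card_subtype, ← Finset.card_image_of_injective _ ha]
  refine (Finset.card_le_card fun x hx => ?_).trans
    ((Multiset.toFinset_card_le f.roots).trans (card_roots' f))
  simp only [Finset.mem_image, Finset.mem_filter, Finset.mem_univ, true_and] at hx
  obtain ⟨i, hi, rfl⟩ := hx
  rw [hc, mul_eq_zero, or_iff_right (hv i)] at hi
  simpa [hf] using hi

/-- If all the weights `∏_{j ≠ i} (aᵢ - aⱼ)` lie in one square class, then a suitable evaluation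
code at the points `aᵢ` is MDS and self-dual. -/
lemma exists_isMDSSelfDual_of_isSquare (hk : 0 < k) (hn : n = 2 * k)
    (ha : Function.Injective a) (lam : F) (hlam : lam ≠ 0)
    (h : ∀ i, IsSquare (lam * ∏ j ∈ univ.erase i, (a i - a j))) :
    ∃ C : Submodule F (Fin n → F), IsMDSSelfDual C := by
  classical
  choose w hw using h
  have hne : ∀ i, ∏ j ∈ univ.erase i, (a i - a j) ≠ 0 := fun i =>
    Finset.prod_ne_zero_iff.2 fun j hj => sub_ne_zero.2 fun e => (Finset.mem_erase.1 hj).1 (ha e).symm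
  have hw0 : ∀ i, w i ≠ 0 := by
    intro i h0
    have := hw i
    rw [h0, mul_zero] at this
    exact mul_ne_zero hlam (hne i) this
  have hv0 : ∀ i, (w i)⁻¹ ≠ 0 := fun i => inv_ne_zero (hw0 i)
  have key : ∀ P : F[X], P.degree < n →
      ∑ i, (w i)⁻¹ * (w i)⁻¹ * P.eval (a i) = lam⁻¹ * P.coeff (n - 1) := by
    intro P hP
    have := Lagrange.coeff_eq_sum (s := univ) (v := a) (ha.injOn) (P := P) (by simpa using hP)
    rw [Finset.card_univ, Fintype.card_fin] at this
    rw [this, Finset.mul_sum]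
    refine Finset.sum_congr rfl fun i _ => ?_
    have h1 : ∏ j ∈ univ.erase i, (a i - a j) = lam⁻¹ * (w i * w i) := by
      rw [← hw i]; field_simp
    rw [h1]
    have := hw0 i
    field_simp
  refine ⟨evalCode a (fun i => (w i)⁻¹) k, le_antisymm ?_ ?_, ?_, ?_⟩
  · intro x hx c hc
    obtain ⟨f, hf, hxf⟩ := mem_evalCode.1 hx
    obtain ⟨g, hg, hcg⟩ := mem_evalCode.1 hc
    have hfg : (f * g).degree < ((n - 1 : ℕ) : WithBot ℕ) := by
      rcases eq_or_ne f 0 with rfl | hf0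
      · simp
      rcases eq_or_ne g 0 with rfl | hg0
      · simp
      rw [degree_eq_natDegree hf0] at hf
      rw [degree_eq_natDegree hg0] at hg
      rw [degree_mul, degree_eq_natDegree hf0, degree_eq_natDegree hg0]
      norm_cast at hf hg ⊢
      omega
    have := key (f * g) (hfg.trans_le (by norm_cast; omega))
    rw [coeff_eq_zero_of_degree_lt hfg, mul_zero] at this
    rw [← this]
    refine Finset.sum_congr rfl fun i _ => ?_
    rw [hxf, hcg, eval_mul]
    ring
  · intro x hx
    let g := Lagrange.interpolate univ a (fun i => w i * x i)
    have hgd : g.degree < n := by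
      have := Lagrange.degree_interpolate_lt (s := univ) (fun i => w i * x i) ha.injOn
      rwa [Finset.card_univ, Fintype.card_fin] at this
    have hge : ∀ i, x i = (w i)⁻¹ * g.eval (a i) := by
      intro i
      have := Lagrange.eval_interpolate_at_node (s := univ) (fun i => w i * x i) (ha.injOn)
        (Finset.mem_univ i)
      rw [this, inv_mul_cancel_left₀ (hw0 i)]
    refine mem_evalCode.2 ⟨g, ?_, hge⟩
    by_contra hcon
    have hg0 : g ≠ 0 := by
      rintro h0
      rw [h0, degree_zero] at hcon
      exact hcon (WithBot.bot_lt_coe _)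
    rw [degree_eq_natDegree hg0] at hcon hgd
    norm_cast at hcon hgd
    have hmem : (fun i => (w i)⁻¹ * (X ^ (n - 1 - g.natDegree) : F[X]).eval (a i)) ∈
        evalCode a (fun i => (w i)⁻¹) k := by
      refine mem_evalCode.2 ⟨_, ?_, fun i => rfl⟩
      rw [degree_X_pow]
      norm_cast
      omega
    have h0 := hx _ hmem
    have h1 := key (g * X ^ (n - 1 - g.natDegree)) (by
      rw [degree_mul, degree_X_pow, degree_eq_natDegree hg0]
      norm_cast
      omega)
    have h2 : (g * X ^ (n - 1 - g.natDegree)).coeff (n - 1) = g.leadingCoeff := by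
      have := coeff_mul_X_pow g (n - 1 - g.natDegree) g.natDegree
      rwa [show g.natDegree + (n - 1 - g.natDegree) = n - 1 by omega] at this
    rw [h2] at h1
    refine mul_ne_zero (inv_ne_zero hlam) (leadingCoeff_ne_zero.2 hg0) (h1.symm.trans ?_)
    rw [← h0]
    refine Finset.sum_congr rfl fun i _ => ?_
    rw [hge, eval_mul]
    ring
  · intro c hc hc0
    obtain ⟨f, hf, hcf⟩ := mem_evalCode.1 hc
    have hf0 : f ≠ 0 := by
      rintro rfl
      exact hc0 (funext fun i => by simp [hcf])
    have h1 := card_zeros_le_natDegree ha hv0 hf0 hcf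
    have h2 := hWeight_add_card_zeros c
    rw [degree_eq_natDegree hf0] at hf
    norm_cast at hf
    omega
  · obtain ⟨s, -, hs⟩ := Finset.exists_subset_card_eq (s := (univ : Finset (Fin n))) (n := k - 1)
      (by simp; omega)
    have hf0 : Lagrange.nodal s a ≠ 0 := Lagrange.nodal_ne_zero
    let c : Fin n → F := fun i => (w i)⁻¹ * (Lagrange.nodal s a).eval (a i)
    have hnd : (Lagrange.nodal s a).natDegree = k - 1 := by rw [Lagrange.natDegree_nodal, hs]
    have h1 : Nat.card {i : Fin n // c i = 0} = k - 1 := by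
      refine le_antisymm ((card_zeros_le_natDegree ha hv0 hf0 (fun i => rfl)).trans hnd.le) ?_
      rw [Nat.card_eq_fintype_card, Fintype.card_subtype, ← hs]
      refine Finset.card_le_card fun i hi => ?_
      simp [c, Lagrange.eval_nodal_at_node hi]
    have h2 := hWeight_add_card_zeros c
    refine ⟨c, mem_evalCode.2 ⟨_, ?_, fun i => rfl⟩, ?_, by omega⟩
    · rw [degree_eq_natDegree hf0, hnd]
      norm_cast
      omega
    · intro h0
      have h3 : hWeight c = 0 := by simp [hWeight, h0]
      omega

/-- Finset form of `exists_isMDSSelfDual_of_isSquare`. -/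
lemma exists_isMDSSelfDual_of_finset [DecidableEq F] (S : Finset F) (hS : #S = n) (hn : Even n)
    (hpos : 0 < n) (lam : F) (hlam : lam ≠ 0)
    (h : ∀ x ∈ S, IsSquare (lam * ∏ y ∈ S.erase x, (x - y))) :
    ∃ C : Submodule F (Fin n → F), IsMDSSelfDual C := by
  obtain ⟨k, hk⟩ := hn
  let φ : Fin n ≃ S := (S.equivFinOfCardEq hS).symm
  have hinj : Function.Injective (fun i => (φ i : F)) := Subtype.val_injective.comp φ.injective
  refine exists_isMDSSelfDual_of_isSquare (k := k) (by omega) (by omega) hinj lam hlam fun i => ?_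
  convert h _ (φ i).2 using 2
  refine Finset.prod_bij (fun j _ => (φ j : F)) ?_ (fun _ _ _ _ e => hinj e) ?_ (fun _ _ => rfl)
  · intro j hj
    exact Finset.mem_erase.2 ⟨fun e => (Finset.mem_erase.1 hj).1 (hinj e), (φ j).2⟩
  · intro b hb
    obtain ⟨hb1, hb2⟩ := Finset.mem_erase.1 hb
    refine ⟨φ.symm ⟨b, hb2⟩, Finset.mem_erase.2 ⟨?_, Finset.mem_univ _⟩, by simp⟩
    rintro rfl
    simp at hb1

end EvalCode

section PowerPreimage

open Polynomial

variable {F : Type*} [Field F] [Fintype F]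

lemma exists_isPrimitiveRoot_of_dvd {N : ℕ} (hN : N ∣ Fintype.card F - 1) :
    ∃ ζ : F, IsPrimitiveRoot ζ N := by
  classical
  obtain ⟨g, hg⟩ := IsCyclic.exists_generator (α := Fˣ)
  have h1 : orderOf g = Fintype.card F - 1 := by
    rw [orderOf_eq_card_of_forall_mem_zpowers hg, Nat.card_eq_fintype_card, Fintype.card_units]
  have h2 : IsPrimitiveRoot (g : F) (Fintype.card F - 1) := by
    rw [← h1]; exact IsPrimitiveRoot.coe_units_iff.2 (IsPrimitiveRoot.orderOf g)
  obtain ⟨d, hd⟩ := hN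
  exact ⟨_, h2.pow (by have := Fintype.one_lt_card (α := F); omega) (hd.trans (mul_comm _ _))⟩

variable [DecidableEq F]

lemma card_filter_pow_eq {N : ℕ} (hN : N ∣ Fintype.card F - 1) {b : F} (hb : b ≠ 0) :
    #{x : F | x ^ N = b ^ N} = N := by
  have hN0 : 0 < N := Nat.pos_of_dvd_of_pos hN
    (by have := Fintype.one_lt_card (α := F); omega)
  obtain ⟨ζ, hζ⟩ := exists_isPrimitiveRoot_of_dvd hN
  refine Eq.trans ?_ hζ.card_nthRootsFinset
  refine (Finset.card_bij (fun x _ => b * x) ?_ (fun _ _ _ _ e => mul_left_cancel₀ hb e) ?_).symm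
  · intro x hx
    rw [Polynomial.mem_nthRootsFinset hN0] at hx
    simp [mul_pow, hx]
  · intro y hy
    simp only [Finset.mem_filter, Finset.mem_univ, true_and] at hy
    refine ⟨b⁻¹ * y, ?_, by field_simp⟩
    rw [Polynomial.mem_nthRootsFinset hN0, mul_pow, hy, inv_pow, inv_mul_cancel₀ (pow_ne_zero _ hb)]

lemma prod_X_sub_C_filter_pow_eq {N : ℕ} (hN : N ∣ Fintype.card F - 1) {b : F} (hb : b ≠ 0) :
    ∏ x ∈ ({x : F | x ^ N = b ^ N} : Finset F), (X - C x) = X ^ N - C (b ^ N) := by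
  have hN0 : 0 < N := Nat.pos_of_dvd_of_pos hN
    (by have := Fintype.one_lt_card (α := F); omega)
  have hc := card_filter_pow_eq hN hb
  have hm : (X ^ N - C (b ^ N)).Monic := monic_X_pow_sub_C _ hN0.ne'
  have hd : (X ^ N - C (b ^ N) : F[X]).degree = (N : WithBot ℕ) := degree_X_pow_sub_C hN0 _
  change Lagrange.nodal _ id = _
  refine eq_of_degree_sub_lt_of_eval_finset_eq ({x : F | x ^ N = b ^ N} : Finset F) ?_ ?_
  · have hd' : (Lagrange.nodal ({x : F | x ^ N = b ^ N} : Finset F) id).degree = N := by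
      rw [Lagrange.degree_nodal, hc]
    rw [hc, ← hd']
    exact degree_sub_lt_left (hd'.trans hd.symm) Lagrange.nodal_ne_zero
      ((Lagrange.nodal_monic).leadingCoeff.trans hm.leadingCoeff.symm)
  · intro x hx
    have h0 := Lagrange.eval_nodal_at_node (v := id) hx
    simp only [id] at h0
    simp only [Finset.mem_filter, Finset.mem_univ, true_and] at hx
    rw [h0]
    simp [hx]

variable {N : ℕ} {Y : Finset F}

lemma nodal_pow_preimage (hN : N ∣ Fintype.card F - 1) (hY : ∀ y ∈ Y, ∃ b, b ≠ 0 ∧ b ^ N = y) :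
    Lagrange.nodal ({x : F | x ^ N ∈ Y} : Finset F) id = (Lagrange.nodal Y id).comp (X ^ N) := by
  simp only [Lagrange.nodal, id, Polynomial.prod_comp, sub_comp, X_comp, C_comp]
  rw [← Finset.prod_fiberwise_of_maps_to (s := ({x : F | x ^ N ∈ Y} : Finset F)) (t := Y)
    (g := fun x => x ^ N) (by simp)]
  refine Finset.prod_congr rfl fun y hy => ?_
  obtain ⟨b, hb, rfl⟩ := hY y hy
  rw [← prod_X_sub_C_filter_pow_eq hN hb]
  refine Finset.prod_congr ?_ fun _ _ => rfl
  ext x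
  simp only [Finset.mem_filter, Finset.mem_univ, true_and]
  exact ⟨fun h => h.2, fun h => ⟨h ▸ hy, h⟩⟩

lemma card_pow_preimage (hN : N ∣ Fintype.card F - 1) (hY : ∀ y ∈ Y, ∃ b, b ≠ 0 ∧ b ^ N = y) :
    #{x : F | x ^ N ∈ Y} = N * #Y := by
  have := congrArg natDegree (nodal_pow_preimage hN hY)
  rwa [natDegree_comp, natDegree_X_pow, Lagrange.natDegree_nodal, Lagrange.natDegree_nodal,
    mul_comm] at this

lemma prod_sub_pow_preimage (hN : N ∣ Fintype.card F - 1)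
    (hY : ∀ y ∈ Y, ∃ b, b ≠ 0 ∧ b ^ N = y) {x : F} (hx : x ^ N ∈ Y) :
    ∏ y ∈ ({x : F | x ^ N ∈ Y} : Finset F).erase x, (x - y) =
      N * x ^ (N - 1) * ∏ z ∈ Y.erase (x ^ N), (x ^ N - z) := by
  have h := congrArg (fun f => f.derivative.eval x) (nodal_pow_preimage hN hY)
  have h1 := Lagrange.eval_nodal_derivative_eval_node_eq (v := id)
    (s := ({x : F | x ^ N ∈ Y} : Finset F)) (i := x) (by simpa using hx)
  have h2 := Lagrange.eval_nodal_derivative_eval_node_eq (v := id) (s := Y) (i := x ^ N) hx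
  simp only [id, derivative_comp, eval_mul, eval_comp, derivative_X_pow, eval_pow, eval_X,
    eval_C] at h h1 h2
  rw [h1, h2, Lagrange.eval_nodal, Lagrange.eval_nodal] at h
  simpa using h

end PowerPreimage

section SubspaceTranslates

variable {F : Type*} [Field F] {E : Subfield F} {V : Submodule E F}
  {T W : Finset F} {y : F}

lemma mul_mem_submodule_iff {δ : F} (hδ : δ ∈ E) (h0 : δ ≠ 0) {w : F} : δ * w ∈ V ↔ w ∈ V :=
  V.smul_mem_iff (s := (⟨δ, hδ⟩ : E)) (fun h => h0 (congrArg Subtype.val h))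

lemma injOn_translates (hT : ∀ τ ∈ T, τ ∈ E) (hW : ∀ w, w ∈ W ↔ w ∈ V) (hy : y ∉ V) :
    Set.InjOn (fun z : F × F => z.1 * y + z.2) (T ×ˢ W : Finset (F × F)) := by
  rintro ⟨a, v⟩ h1 ⟨b, w⟩ h2 h
  simp only [Finset.coe_product, Set.mem_prod, Finset.mem_coe, hW] at h1 h2 h
  have hab : a = b := by
    by_contra hne
    refine hy ((mul_mem_submodule_iff (sub_mem (hT _ h1.1) (hT _ h2.1)) (sub_ne_zero.2 hne)).1 ?_)
    rw [show (a - b) * y = w - v by linear_combination h]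
    exact sub_mem h2.2 h1.2
  subst hab
  simpa using h

lemma prod_translate_sub (hW : ∀ w, w ∈ W ↔ w ∈ V) {v δ : F} (hv : v ∈ V) (hδ : δ ∈ E)
    (h0 : δ ≠ 0) : ∏ w ∈ W, (δ * y + v - w) = δ ^ #W * ∏ w ∈ W, (y - w) := by
  rw [← Finset.prod_const, ← Finset.prod_mul_distrib]
  refine (Finset.prod_bij' (fun w _ => v + δ * w) (fun w _ => δ⁻¹ * (w - v)) ?_ ?_ ?_ ?_ ?_).symm
  · intro w hw
    rw [hW] at hw ⊢
    exact add_mem hv ((mul_mem_submodule_iff hδ h0).2 hw)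
  · intro w hw
    rw [hW] at hw ⊢
    exact (mul_mem_submodule_iff (inv_mem hδ) (inv_ne_zero h0)).2 (sub_mem hw hv)
  · intro w _
    field_simp
    ring
  · intro w _
    field_simp
    ring
  · intro w _
    ring

variable [DecidableEq F]

lemma prod_erase_translate (hW : ∀ w, w ∈ W ↔ w ∈ V) {v : F} (hv : v ∈ V) :
    ∏ w ∈ W.erase v, (v - w) = ∏ w ∈ W.erase 0, w := by
  refine Finset.prod_bij' (fun w _ => v - w) (fun w _ => v - w) ?_ ?_ ?_ ?_ ?_
  · intro w hw
    simp only [Finset.mem_erase, hW] at hw ⊢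
    exact ⟨sub_ne_zero.2 hw.1.symm, sub_mem hv hw.2⟩
  · intro w hw
    simp only [Finset.mem_erase, hW] at hw ⊢
    exact ⟨fun h => hw.1 (by simpa using h), sub_mem hv hw.2⟩
  all_goals simp

/-- The difference product at a point of `⋃ τ ∈ T, (τ y + V)`. -/
lemma prod_erase_translates (hT : ∀ τ ∈ T, τ ∈ E) (hW : ∀ w, w ∈ W ↔ w ∈ V) (hy : y ∉ V)
    {τ v : F} (hτ : τ ∈ T) (hv : v ∈ V) :
    ∏ z ∈ ((T ×ˢ W).image fun z => z.1 * y + z.2).erase (τ * y + v), (τ * y + v - z) =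
      (∏ w ∈ W.erase 0, w) * (∏ w ∈ W, (y - w)) ^ (#T - 1) *
        (∏ σ ∈ T.erase τ, (τ - σ)) ^ #W := by
  have hinj := injOn_translates hT hW hy
  have herase : ((T ×ˢ W).image fun z => z.1 * y + z.2).erase (τ * y + v) =
      (((T ×ˢ W).erase (τ, v)).image fun z => z.1 * y + z.2) := by
    ext x
    simp only [Finset.mem_erase, Finset.mem_image]
    constructor
    · rintro ⟨hx, z, hz, rfl⟩
      exact ⟨z, ⟨fun h => hx (by rw [h]), hz⟩, rfl⟩
    · rintro ⟨z, ⟨hne, hz⟩, rfl⟩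
      exact ⟨fun h => hne (hinj hz (Finset.mem_product.2 ⟨hτ, (hW v).2 hv⟩) h), z, hz, rfl⟩
  have hsplit : (T ×ˢ W).erase (τ, v) = ({τ} ×ˢ W.erase v) ∪ (T.erase τ ×ˢ W) := by
    ext ⟨a, b⟩
    by_cases h : a = τ
    · simp [h, hτ]
    · simp [h, Ne.symm h]
  have hdisj : Disjoint ({τ} ×ˢ W.erase v) (T.erase τ ×ˢ W) := by
    rw [Finset.disjoint_left]
    rintro ⟨a, b⟩ h1 h2
    simp only [Finset.mem_product, Finset.mem_singleton, Finset.mem_erase] at h1 h2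
    exact h2.1.1 h1.1
  rw [herase, Finset.prod_image (hinj.mono (Finset.coe_subset.2 (Finset.erase_subset _ _))), hsplit,
    Finset.prod_union hdisj, Finset.prod_product, Finset.prod_product, Finset.prod_singleton]
  simp only [add_sub_add_left_eq_sub]
  have key : ∀ σ ∈ T.erase τ, ∏ w ∈ W, (τ * y + v - (σ * y + w)) =
      (∏ w ∈ W, (y - w)) * (τ - σ) ^ #W := by
    intro σ hσ
    obtain ⟨hne, hσT⟩ := Finset.mem_erase.1 hσ
    rw [mul_comm (∏ w ∈ W, (y - w)), ← prod_translate_sub hW hv (sub_mem (hT _ hτ) (hT _ hσT))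
      (sub_ne_zero.2 hne.symm)]
    exact Finset.prod_congr rfl fun w _ => by ring
  rw [prod_erase_translate hW hv, Finset.prod_congr rfl key, Finset.prod_mul_distrib,
    Finset.prod_const, Finset.prod_pow, Finset.card_erase_of_mem hτ, mul_assoc]

end SubspaceTranslates

section FiniteField

variable {F : Type*} [Field F] [Fintype F]

lemma natCast_ne_zero_of_dvd_card_sub_one {n : ℕ} (hn : n ∣ Fintype.card F - 1) :
    (n : F) ≠ 0 := by
  obtain ⟨d, hd⟩ := hn
  intro h0
  have h1 : Fintype.card F = n * d + 1 := by
    have := Fintype.one_lt_card (α := F)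
    omega
  have h2 : ((Fintype.card F : ℕ) : F) = 0 := FiniteField.cast_card_eq_zero F
  rw [h1] at h2
  simp [h0] at h2

lemma exists_pow_eq_of_pow_eq_one {N d : ℕ} (h : N * d = Fintype.card F - 1) {y : F}
    (hy : y ^ d = 1) : ∃ b, b ≠ 0 ∧ b ^ N = y := by
  have hpos : 0 < N * d := by
    have := Fintype.one_lt_card (α := F)
    omega
  have hd : 0 < d := Nat.pos_of_mul_pos_left hpos
  have : NeZero (N * d) := ⟨hpos.ne'⟩
  obtain ⟨g, hg⟩ := exists_isPrimitiveRoot_of_dvd (F := F) (dvd_of_eq h)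
  obtain ⟨i, -, rfl⟩ := hg.eq_pow_of_pow_eq_one (ξ := y) (by rw [mul_comm, pow_mul, hy, one_pow])
  rw [← pow_mul, hg.pow_eq_one_iff_dvd] at hy
  obtain ⟨j, rfl⟩ := Nat.dvd_of_mul_dvd_mul_right hd hy
  exact ⟨g ^ j, pow_ne_zero _ (hg.ne_zero hpos.ne'), by rw [← pow_mul, mul_comm]⟩

lemma card_pow_eq_self {R : ℕ} (hR : 1 < R) (h : R - 1 ∣ Fintype.card F - 1) :
    Nat.card {x : F // x ^ R = x} = R := by
  classical
  have h1 := card_filter_pow_eq h (one_ne_zero (α := F))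
  have h2 : ({x : F | x ^ R = x} : Finset F) =
      insert 0 ({x : F | x ^ (R - 1) = 1 ^ (R - 1)} : Finset F) := by
    ext x
    obtain ⟨m, rfl⟩ : ∃ m, R = m + 1 := ⟨R - 1, by omega⟩
    rcases eq_or_ne x 0 with rfl | hx
    · simp
    · simp [hx, pow_succ]
  rw [Nat.card_eq_fintype_card, Fintype.card_subtype, h2, Finset.card_insert_of_notMem, h1]
  · omega
  · simp [show R - 1 ≠ 0 by omega]

/-- A union of two cosets of the `h`-th roots of unity, consisting of squares, all of whose
difference products lie in one square class. -/
lemma exists_finset_isSquare_prod_sub [DecidableEq F] {d h : ℕ} (hd : d ∣ Fintype.card F - 1)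
    (hh : 2 * h ∣ d) (hlt : 2 * h < d) (hneg : IsSquare (-1 : F)) :
    ∃ T : Finset F, #T = 2 * h ∧ (∀ τ ∈ T, τ ^ d = 1) ∧
      ∃ c : F, c ≠ 0 ∧ ∀ τ ∈ T, IsSquare (c * ∏ σ ∈ T.erase τ, (τ - σ)) := by
  have : NeZero d := ⟨by omega⟩
  obtain ⟨g, hg⟩ := exists_isPrimitiveRoot_of_dvd hd
  have hg0 : g ≠ 0 := hg.ne_zero (NeZero.ne d)
  obtain ⟨u, hu⟩ := hh
  have hu0 : 0 < h * u := by
    rw [pos_iff_ne_zero]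
    intro h0
    rw [mul_assoc, h0] at hu
    omega
  have hhF : h ∣ Fintype.card F - 1 := (Dvd.intro_left 2 rfl).trans ((Dvd.intro u hu.symm).trans hd)
  have h0 : 0 < h := Nat.pos_of_mul_pos_right hu0
  have hc1 : (1 : F) ≠ (g ^ 2) ^ h := by
    intro h1
    rw [← pow_mul] at h1
    exact absurd (Nat.le_of_dvd (by omega) ((hg.pow_eq_one_iff_dvd _).1 h1.symm)) (by omega)
  set c := (g ^ 2) ^ h with hc
  let Y : Finset F := {1, c}
  have hY : ∀ y ∈ Y, ∃ b, b ≠ 0 ∧ b ^ h = y := by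
    intro y hy
    rcases Finset.mem_insert.1 hy with rfl | hy
    · exact ⟨1, one_ne_zero, one_pow _⟩
    · exact ⟨g ^ 2, pow_ne_zero _ hg0, (Finset.mem_singleton.1 hy).symm⟩
  have hroot : ∀ τ : F, τ ^ h ∈ Y → ∃ b, b ≠ 0 ∧ τ = b ^ 2 := by
    intro τ hτ
    have h1 : τ ^ (h * u) = 1 := by
      rw [pow_mul]
      rcases Finset.mem_insert.1 hτ with h1 | h1
      · rw [h1, one_pow]
      · rw [Finset.mem_singleton.1 h1, hc, ← pow_mul, ← pow_mul, ← mul_assoc, ← hu, hg.pow_eq_one]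
    have : NeZero (h * u) := ⟨hu0.ne'⟩
    have hg2 : IsPrimitiveRoot (g ^ 2) (h * u) := hg.pow (NeZero.pos d) (by rw [hu, mul_assoc])
    obtain ⟨i, -, rfl⟩ := hg2.eq_pow_of_pow_eq_one h1
    exact ⟨g ^ i, pow_ne_zero _ hg0, by rw [← pow_mul, ← pow_mul, mul_comm]⟩
  refine ⟨({x : F | x ^ h ∈ Y} : Finset F), ?_, ?_, h * (1 - c),
    mul_ne_zero (natCast_ne_zero_of_dvd_card_sub_one hhF) (sub_ne_zero.2 hc1), ?_⟩
  · rw [card_pow_preimage hhF hY, Finset.card_pair hc1, mul_comm]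
  · intro τ hτ
    simp only [Finset.mem_filter, Finset.mem_univ, true_and] at hτ
    rw [hu, mul_comm 2 h, mul_assoc, pow_mul]
    rcases Finset.mem_insert.1 hτ with h1 | h1
    · rw [h1, one_pow]
    · rw [Finset.mem_singleton.1 h1, hc, ← pow_mul, ← pow_mul, show 2 * (h * (2 * u)) = d * 2 by
        rw [hu]; ring, pow_mul, hg.pow_eq_one, one_pow]
  · intro τ hτ
    simp only [Finset.mem_filter, Finset.mem_univ, true_and] at hτ
    rw [prod_sub_pow_preimage hhF hY hτ]
    obtain ⟨b, hb, rfl⟩ := hroot τ hτ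
    obtain ⟨i, hi⟩ := hneg
    rcases Finset.mem_insert.1 hτ with h1 | h1
    · rw [h1, show Y.erase 1 = {c} from Finset.erase_insert (by simpa using hc1),
        Finset.prod_singleton]
      exact ⟨h * (1 - c) * b ^ (h - 1), by ring⟩
    · rw [Finset.mem_singleton.1 h1, show Y.erase c = {1} by
        rw [show Y = {c, 1} from Finset.pair_comm _ _]
        exact Finset.erase_insert (by simpa using hc1.symm), Finset.prod_singleton]
      refine ⟨h * (1 - c) * b ^ (h - 1) * i, ?_⟩
      linear_combination (h * (1 - c) * b ^ (h - 1)) ^ 2 * hi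

end FiniteField

section Subspace

/-- A finite module contains subspaces of every smaller dimension. -/
lemma exists_submodule_card_eq {K M : Type*} [Field K] [Finite K] [AddCommGroup M] [Module K M]
    [Finite M] (A : Submodule K M) {s e : ℕ} (hA : Nat.card A = Nat.card K ^ s) (he : e < s) :
    ∃ V : Submodule K M, V ≤ A ∧ Nat.card V = Nat.card K ^ e ∧ ∃ y ∈ A, y ∉ V := by
  have hK : 1 < Nat.card K := Finite.one_lt_card
  have hs : Module.finrank K A = s := by
    rw [Module.natCard_eq_pow_finrank (K := K)] at hA
    exact Nat.pow_right_injective hK hA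
  obtain ⟨v, hv⟩ := exists_linearIndependent_of_le_finrank (R := K) (M := A) (n := e) (by omega)
  let B : Submodule K A := Submodule.span K (Set.range v)
  have hcard : Nat.card (B.map A.subtype) = Nat.card K ^ e := by
    rw [Module.natCard_eq_pow_finrank (K := K),
      LinearEquiv.finrank_eq (Submodule.equivMapOfInjective A.subtype A.injective_subtype B).symm,
      finrank_span_eq_card hv, Fintype.card_fin]
  refine ⟨B.map A.subtype, Submodule.map_subtype_le A B, hcard, ?_⟩
  by_contra! hcon
  have h1 : B.map A.subtype = A := le_antisymm (Submodule.map_subtype_le A B) hcon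
  rw [h1, hA] at hcard
  exact he.ne' (Nat.pow_right_injective hK hcard)

variable {F : Type*} [Field F] (p k : ℕ) [Fact p.Prime] [CharP F p]

/-- The subfield of elements fixed by `x ↦ x ^ p ^ k`. -/
def frobeniusFixedField : Subfield F :=
  (iterateFrobenius F p k).eqLocusField (RingHom.id F)

lemma mem_frobeniusFixedField {x : F} : x ∈ frobeniusFixedField p k ↔ x ^ p ^ k = x := Iff.rfl

lemma pow_pow_eq_self {M : Type*} [Monoid M] {x : M} {r : ℕ} (h : x ^ r = x) (s : ℕ) :
    x ^ r ^ s = x := by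
  induction s with
  | zero => simp
  | succ s ih => rw [pow_succ, pow_mul, ih, h]

/-- The elements fixed by `x ↦ x ^ (p ^ k) ^ s`, as a subspace over those fixed by
`x ↦ x ^ p ^ k`. -/
def frobeniusFixedSubmodule (s : ℕ) : Submodule (frobeniusFixedField (F := F) p k) F where
  carrier := {x | x ^ (p ^ k) ^ s = x}
  add_mem' {a b} ha hb := by
    have ha' : a ^ p ^ (k * s) = a := by rw [pow_mul]; exact ha
    have hb' : b ^ p ^ (k * s) = b := by rw [pow_mul]; exact hb
    change (a + b) ^ (p ^ k) ^ s = a + b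
    rw [← pow_mul, add_pow_char_pow, ha', hb']
  zero_mem' := zero_pow (pow_ne_zero _ (pow_ne_zero _ (Fact.out : p.Prime).ne_zero))
  smul_mem' c x hx := by
    change (c * x : F) ^ (p ^ k) ^ s = c * x
    rw [mul_pow, pow_pow_eq_self c.2 s]
    exact congrArg _ hx

end Subspace

section Length

variable (r s : ℕ) (m : ℕ → ℕ)

lemma prod_geom_sum_mul (hr : 0 < r) (l : ℕ) :
    (∏ i ∈ range l, ∑ j ∈ range (m i), r ^ (s * (∏ x ∈ range i, m x) * j)) * (r ^ s - 1) =
      r ^ (s * ∏ i ∈ range l, m i) - 1 := by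
  induction l with
  | zero => simp
  | succ l ih =>
    rw [prod_range_succ, mul_right_comm, ih, prod_range_succ, ← mul_assoc]
    simp only [pow_mul r (s * ∏ x ∈ range l, m x)]
    have h := Nat.one_le_pow (s * ∏ x ∈ range l, m x) r hr
    generalize r ^ (s * ∏ x ∈ range l, m x) = a at h ⊢
    have h2 := Nat.one_le_pow (m l) a h
    zify [h, h2]
    rw [mul_comm, geom_sum_mul]

lemma odd_prod_geom_sum (hr : Odd r) {l : ℕ} (hm : Odd (∏ i ∈ range l, m i)) :
    Odd (∏ i ∈ range l, ∑ j ∈ range (m i), r ^ (s * (∏ x ∈ range i, m x) * j)) := by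
  refine Finset.prod_induction _ Odd (fun _ _ => Odd.mul) odd_one fun i hi => ?_
  rw [Finset.odd_sum_iff_odd_card_odd, Finset.filter_true_of_mem fun j _ => hr.pow,
    Finset.card_range]
  exact hm.of_dvd_nat (Finset.dvd_prod_of_mem _ hi)

end Length

/-- If `N = (q - 1) / (r ^ s - 1)` is odd, there is an MDS self-dual code of length `t r ^ e N`. -/
lemma exists_isMDSSelfDual_of_odd {r s e t p k N : ℕ} [Fact p.Prime] (hr : r = p ^ k) (hs : 0 < s)
    (ht : Even t) (hdvd : t ∣ r - 1) (ht0 : 0 < t) (ht2 : t < r - 1) (he : e < s)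
    {F : Type*} [Field F] [Fintype F] [CharP F p] (hq4 : Fintype.card F % 4 ≠ 3)
    (hNodd : Odd N) (hNQ : N * (r ^ s - 1) = Fintype.card F - 1) :
    ∃ C : Submodule F (Fin (t * r ^ e * N) → F), IsMDSSelfDual C := by
  classical
  have hr1 : 1 < r := by omega
  have hN : N ∣ Fintype.card F - 1 := Dvd.intro _ hNQ
  have hQ : r ^ s - 1 ∣ Fintype.card F - 1 := Dvd.intro_left _ hNQ
  have hR : r - 1 ∣ Fintype.card F - 1 :=
    (by simpa using Nat.sub_dvd_pow_sub_pow r 1 s : r - 1 ∣ r ^ s - 1).trans hQ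
  have hQ1 : 1 < r ^ s := Nat.one_lt_pow hs.ne' hr1
  have hcardE : Nat.card (frobeniusFixedField (F := F) p k) = r := by
    rw [← card_pow_eq_self hr1 hR]
    simp only [← SetLike.mem_coe]
    subst hr
    rfl
  have hcardA : Nat.card (frobeniusFixedSubmodule (F := F) p k s) =
      Nat.card (frobeniusFixedField (F := F) p k) ^ s := by
    rw [hcardE, ← card_pow_eq_self hQ1 hQ]
    subst hr
    rfl
  obtain ⟨V, hVA, hcardV, y, hyA, hy⟩ := exists_submodule_card_eq _ hcardA he
  rw [hcardE] at hcardV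
  obtain ⟨h, rfl⟩ := ht.two_dvd
  obtain ⟨T, hTcard, hT1, c, hc, hTsq⟩ := exists_finset_isSquare_prod_sub hR hdvd ht2
    (FiniteField.isSquare_neg_one_iff.2 hq4)
  have hTE : ∀ τ ∈ T, τ ∈ frobeniusFixedField (F := F) p k := by
    intro τ hτ
    rw [mem_frobeniusFixedField, ← hr, show r = r - 1 + 1 by omega, pow_succ, hT1 τ hτ, one_mul]
  let W : Finset F := {w | w ∈ V}
  have hW : ∀ w, w ∈ W ↔ w ∈ V := by simp [W]
  have hWcard : #W = r ^ e := by
    rw [← hcardV, Nat.card_eq_fintype_card, Fintype.card_subtype]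
  let Y := (T ×ˢ W).image fun z => z.1 * y + z.2
  have hYcard : #Y = 2 * h * r ^ e := by
    rw [Finset.card_image_of_injOn (injOn_translates hTE hW hy), Finset.card_product, hTcard, hWcard]
  have hY : ∀ z ∈ Y, ∃ b, b ≠ 0 ∧ b ^ N = z := by
    intro z hz
    obtain ⟨⟨τ, v⟩, hτv, rfl⟩ := Finset.mem_image.1 hz
    obtain ⟨hτ, hv⟩ := Finset.mem_product.1 hτv
    rw [hW] at hv
    have hτ0 : τ ≠ 0 := by
      rintro rfl
      have := hT1 0 hτ
      rw [zero_pow (by omega)] at this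
      exact zero_ne_one this
    have hmem : τ * y + v ∈ frobeniusFixedSubmodule (F := F) p k s :=
      add_mem ((mul_mem_submodule_iff (hTE τ hτ) hτ0).2 hyA) (hVA hv)
    have hne : τ * y + v ≠ 0 := by
      intro h0
      refine hy ((mul_mem_submodule_iff (hTE τ hτ) hτ0).1 ?_)
      rw [eq_neg_of_add_eq_zero_left h0]
      exact neg_mem hv
    refine exists_pow_eq_of_pow_eq_one hNQ (mul_right_cancel₀ hne ?_)
    rw [← pow_succ, Nat.sub_add_cancel hQ1.le, one_mul, hr]
    exact hmem
  have hNF := natCast_ne_zero_of_dvd_card_sub_one hN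
  have hw0 : ∏ w ∈ W.erase 0, w ≠ 0 :=
    Finset.prod_ne_zero_iff.2 fun w hw => (Finset.mem_erase.1 hw).1
  have hB0 : ∏ w ∈ W, (y - w) ≠ 0 := Finset.prod_ne_zero_iff.2 fun w hw =>
    sub_ne_zero.2 fun h0 => hy (h0 ▸ (hW w).1 hw)
  refine exists_isMDSSelfDual_of_finset ({x : F | x ^ N ∈ Y} : Finset F) ?_
    (ht.mul_right _ |>.mul_right _) (by have := hNodd.pos; positivity)
    (N * ((∏ w ∈ W.erase 0, w) * (∏ w ∈ W, (y - w)) ^ (#T - 1)) * c ^ #W)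
    (mul_ne_zero (mul_ne_zero hNF (mul_ne_zero hw0 (pow_ne_zero _ hB0))) (pow_ne_zero _ hc)) ?_
  · rw [card_pow_preimage hN hY, hYcard, mul_comm]
  · intro x hx
    simp only [Finset.mem_filter, Finset.mem_univ, true_and] at hx
    rw [prod_sub_pow_preimage hN hY hx]
    obtain ⟨⟨τ, v⟩, hz, hzx⟩ := Finset.mem_image.1 hx
    obtain ⟨hτ, hv⟩ := Finset.mem_product.1 hz
    rw [← hzx, prod_erase_translates hTE hW hy hτ ((hW v).1 hv)]
    obtain ⟨b, hb⟩ := hTsq τ hτ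
    obtain ⟨j, hj⟩ := hNodd
    refine ⟨N * ((∏ w ∈ W.erase 0, w) * (∏ w ∈ W, (y - w)) ^ (#T - 1)) * x ^ j * b ^ #W, ?_⟩
    have hb' : c ^ #W * (∏ σ ∈ T.erase τ, (τ - σ)) ^ #W = b ^ #W * b ^ #W := by
      rw [← mul_pow, hb, mul_pow]
    rw [show N - 1 = j + j by omega, pow_add]
    linear_combination (N * ((∏ w ∈ W.erase 0, w) * (∏ w ∈ W, (y - w)) ^ (#T - 1)) * x ^ j) ^ 2 * hb'

theorem stmt_6 (r s l e t p k : ℕ) (m : ℕ → ℕ) (hp : p.Prime) (hpodd : Odd p)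
    (hr : r = p ^ k) (hk : 0 < k) (hs : 0 < s) (hl : 0 < l)
    (hmodd : Odd (∏ i ∈ Finset.range l, m i))
    (hq4 : r ^ (s * ∏ i ∈ Finset.range l, m i) % 4 = 1)
    (ht : Even t) (hdvd : t ∣ r - 1) (ht0 : 0 < t) (ht2 : t < r - 1) (he : e ≤ s - 1)
    (F : Type*) [Field F] [Fintype F]
    (hF : Fintype.card F = r ^ (s * ∏ i ∈ Finset.range l, m i)) :
    ∃ C : Submodule F (Fin (t * r ^ e *
        ∏ i ∈ Finset.range l, ∑ j ∈ Finset.range (m i),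
          r ^ (s * (∏ x ∈ Finset.range i, m x) * j)) → F),
      IsMDSSelfDual C := by
  have : Fact p.Prime := ⟨hp⟩
  have : CharP F p := charP_of_card_eq_prime_pow
    (f := k * (s * ∏ i ∈ Finset.range l, m i)) (by rw [hF, hr, ← pow_mul])
  have hNQ := prod_geom_sum_mul r s m (by omega) l
  rw [← hF] at hNQ
  exact exists_isMDSSelfDual_of_odd hr hs ht hdvd ht0 ht2 (by omega) (by omega)
    (odd_prod_geom_sum r s m (hr ▸ hpodd.pow) hmodd) hNQ
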